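/- arXiv:2510.20320 — 3 statements merged into one kernel-verified Lean document; each statement's English description precedes it below -/
import Mathlib

section
/- Let d ≥ 1 and k ≥ 0 be integers. There exists a constant C depending only on d and k such that for every compactly supported smooth function u : ℝ^d → ℝ: ∫_{ℝ^d} (1+|x|²)^k · u(x)² dγ_d(x) ≤ C · Σ_{j=0}^{k} ∫_{ℝ^d} |D^j u(x)|² dγ_d(x), where D^j u denotes the j-th iterated (total) derivative of u and |D^j u| its norm. -/
open MeasureTheory Real

/-- The centered Gaussian probability measure on `ℝ^d` with covariance `2·Id`,
i.e. with density `(4π)^{-d/2} e^{-|x|²/4}` with respect to Lebesgue measure. -/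
noncomputable def gaussianCov2 (d : ℕ) : Measure (EuclideanSpace ℝ (Fin d)) :=
  volume.withDensity fun x =>
    ENNReal.ofReal ((4 * π) ^ (-(d : ℝ) / 2) * Real.exp (-‖x‖ ^ 2 / 4))

instance (d : ℕ) : IsLocallyFiniteMeasure (gaussianCov2 d) :=
  IsLocallyFiniteMeasure.withDensity_ofReal (by fun_prop)

theorem Continuous.integrable_gaussianCov2 {d : ℕ} {f : EuclideanSpace ℝ (Fin d) → ℝ}
    (hf : Continuous f) (hs : HasCompactSupport f) : Integrable f (gaussianCov2 d) :=
  hf.integrable_of_hasCompactSupport hs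

theorem integral_gaussianCov2 {d : ℕ} (f : EuclideanSpace ℝ (Fin d) → ℝ) :
    ∫ x, f x ∂(gaussianCov2 d) =
      ∫ x, (4 * π) ^ (-(d : ℝ) / 2) * Real.exp (-‖x‖ ^ 2 / 4) * f x := by
  rw [gaussianCov2, integral_withDensity_eq_integral_toReal_smul (by fun_prop)
    (Filter.Eventually.of_forall fun _ => ENNReal.ofReal_lt_top)]
  refine integral_congr_ae (Filter.Eventually.of_forall fun x => ?_)
  simp only [smul_eq_mul]
  rw [ENNReal.toReal_ofReal (by positivity)]

/-- Divergence theorem for the Gaussian measure applied to the vector field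
`x ↦ xᵢ (1 + |x|²)^k u² eᵢ`. -/
theorem integral_gaussianCov2_coord_eq_zero {d : ℕ} (k : ℕ) (i : Fin d)
    {u : EuclideanSpace ℝ (Fin d) → ℝ} (hu : ContDiff ℝ (⊤ : ℕ∞) u) (hs : HasCompactSupport u) :
    ∫ x, (((1 + ‖x‖ ^ 2) ^ k + 2 * k * x i ^ 2 * (1 + ‖x‖ ^ 2) ^ (k - 1)
        - x i ^ 2 / 2 * (1 + ‖x‖ ^ 2) ^ k) * u x
        + 2 * x i * (1 + ‖x‖ ^ 2) ^ k * fderiv ℝ u x (EuclideanSpace.single i 1)) * u x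
      ∂(gaussianCov2 d) = 0 := by
  have hc : Continuous u := hu.continuous
  have hc' : Continuous fun x => fderiv ℝ u x (EuclideanSpace.single i 1) :=
    (hu.continuous_fderiv (by simp)).clm_apply continuous_const
  rw [integral_gaussianCov2]
  set c : ℝ := (4 * π) ^ (-(d : ℝ) / 2)
  set g' : EuclideanSpace ℝ (Fin d) → ℝ := fun x => c * Real.exp (-‖x‖ ^ 2 / 4) *
      ((((1 + ‖x‖ ^ 2) ^ k + 2 * k * x i ^ 2 * (1 + ‖x‖ ^ 2) ^ (k - 1)
        - x i ^ 2 / 2 * (1 + ‖x‖ ^ 2) ^ k) * u x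
        + 2 * x i * (1 + ‖x‖ ^ 2) ^ k * fderiv ℝ u x (EuclideanSpace.single i 1)) * u x)
    with hg'
  set g : EuclideanSpace ℝ (Fin d) → ℝ := fun x =>
    (c * Real.exp (-‖x‖ ^ 2 / 4) * x i * (1 + ‖x‖ ^ 2) ^ k * u x) * u x with hg
  have hgi : Integrable g := by
    refine Continuous.integrable_of_hasCompactSupport (by fun_prop) (hs.mul_left)
  have hgi' : Integrable g' := by
    refine Continuous.integrable_of_hasCompactSupport (by fun_prop) (hs.mul_left.mul_left)
  have hderiv : ∀ x, HasLineDerivAt ℝ g (g' x) x (EuclideanSpace.single i 1) := by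
    intro x
    have hline : HasDerivAt (fun t : ℝ => x + t • EuclideanSpace.single i (1 : ℝ))
        (EuclideanSpace.single i 1) 0 := by
      simpa using ((hasDerivAt_id (0 : ℝ)).smul_const
        (EuclideanSpace.single i (1 : ℝ))).const_add x
    have hU : HasDerivAt (fun t : ℝ => u (x + t • EuclideanSpace.single i (1 : ℝ)))
        (fderiv ℝ u x (EuclideanSpace.single i 1)) 0 := by
      have h := (hu.differentiable (by simp) x).hasFDerivAt
      exact HasFDerivAt.comp_hasDerivAt_of_eq 0 h hline (by simp)
    have hX : HasDerivAt (fun t : ℝ => (x + t • EuclideanSpace.single i (1 : ℝ)) i) 1 0 := by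
      simpa using (hasDerivAt_id (0 : ℝ)).const_add (x i)
    have hN : HasDerivAt (fun t : ℝ => ‖x + t • EuclideanSpace.single i (1 : ℝ)‖ ^ 2)
        (2 * x i) 0 := by
      simpa [EuclideanSpace.inner_single_right] using hline.norm_sq
    have h := (((((hN.neg.div_const 4).exp.const_mul c).mul hX).mul
      ((hN.const_add 1).pow k)).mul hU).mul hU
    unfold HasLineDerivAt
    refine h.congr_deriv ?_
    simp [hg']
    ring
  have h := integral_bilinear_hasLineDerivAt_right_eq_neg_left_of_integrable
    (μ := (volume : Measure (EuclideanSpace ℝ (Fin d)))) (f := fun _ => (1 : ℝ))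
    (f' := fun _ => (0 : ℝ)) (g := g) (g' := g') (v := EuclideanSpace.single i 1)
    (B := ContinuousLinearMap.mul ℝ ℝ)
    (by simp) (by simpa using hgi') (by simpa using hgi)
    (fun x _ => by simpa [HasLineDerivAt] using hasDerivAt_const (0 : ℝ) (1 : ℝ))
    (fun x _ => hderiv x)
  simpa using h

theorem integral_coord_sq_mul_le {d : ℕ} (k : ℕ) (i : Fin d)
    {u : EuclideanSpace ℝ (Fin d) → ℝ} (hu : ContDiff ℝ (⊤ : ℕ∞) u) (hs : HasCompactSupport u) :
    ∫ x, x i ^ 2 * (1 + ‖x‖ ^ 2) ^ k * u x ^ 2 ∂(gaussianCov2 d) ≤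
      (4 + 8 * (k : ℝ)) * ∫ x, (1 + ‖x‖ ^ 2) ^ k * u x ^ 2 ∂(gaussianCov2 d) +
      16 * ∫ x, (1 + ‖x‖ ^ 2) ^ k * fderiv ℝ u x (EuclideanSpace.single i 1) ^ 2
        ∂(gaussianCov2 d) := by
  have hc : Continuous u := hu.continuous
  have hc' : Continuous fun x => fderiv ℝ u x (EuclideanSpace.single i 1) :=
    (hu.continuous_fderiv (by simp)).clm_apply continuous_const
  have hs' : HasCompactSupport fun x => fderiv ℝ u x (EuclideanSpace.single i 1) :=
    hs.fderiv_apply ℝ _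
  have h0 := integral_gaussianCov2_coord_eq_zero k i hu hs
  have i0 : Integrable (fun x => (((1 + ‖x‖ ^ 2) ^ k + 2 * k * x i ^ 2 * (1 + ‖x‖ ^ 2) ^ (k - 1)
        - x i ^ 2 / 2 * (1 + ‖x‖ ^ 2) ^ k) * u x
        + 2 * x i * (1 + ‖x‖ ^ 2) ^ k * fderiv ℝ u x (EuclideanSpace.single i 1)) * u x)
      (gaussianCov2 d) :=
    Continuous.integrable_gaussianCov2 (by fun_prop) hs.mul_left
  have i1 : Integrable (fun x => x i ^ 2 * (1 + ‖x‖ ^ 2) ^ k * u x ^ 2) (gaussianCov2 d) := by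
    simp_rw [pow_two (u _), ← mul_assoc]
    exact Continuous.integrable_gaussianCov2 (by fun_prop) hs.mul_left
  have i2 : Integrable (fun x => (1 + ‖x‖ ^ 2) ^ k * u x ^ 2) (gaussianCov2 d) := by
    simp_rw [pow_two (u _), ← mul_assoc]
    exact Continuous.integrable_gaussianCov2 (by fun_prop) hs.mul_left
  have i3 : Integrable (fun x => (1 + ‖x‖ ^ 2) ^ k *
      fderiv ℝ u x (EuclideanSpace.single i 1) ^ 2) (gaussianCov2 d) := by
    simp_rw [pow_two (fderiv ℝ u _ _), ← mul_assoc]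
    exact Continuous.integrable_gaussianCov2 (by fun_prop) hs'.mul_left
  have key := integral_mono (i1.add (i0.const_mul 4))
    ((i2.const_mul (4 + 8 * k)).add (i3.const_mul 16)) fun x => ?_
  · simp only [Pi.add_apply] at key
    rwa [integral_add i1 (i0.const_mul 4), integral_add (i2.const_mul _) (i3.const_mul _),
      integral_const_mul, integral_const_mul, integral_const_mul, h0, mul_zero, add_zero] at key
  · simp only [Pi.add_apply]
    have hxi : x i ^ 2 ≤ 1 + ‖x‖ ^ 2 := by
      have := PiLp.norm_apply_le x i
      rw [Real.norm_eq_abs] at this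
      nlinarith [sq_abs (x i), abs_nonneg (x i)]
    have hpow : (k : ℝ) * (x i ^ 2 * (1 + ‖x‖ ^ 2) ^ (k - 1)) ≤ k * (1 + ‖x‖ ^ 2) ^ k := by
      rcases k with _ | k
      · simp
      · rw [Nat.add_sub_cancel, pow_succ' (1 + ‖x‖ ^ 2) k]
        gcongr
    have hpow' := mul_le_mul_of_nonneg_right hpow (sq_nonneg (u x))
    have hsq := mul_nonneg (pow_nonneg (by positivity : 0 ≤ 1 + ‖x‖ ^ 2) k)
      (sq_nonneg (x i * u x - 4 * fderiv ℝ u x (EuclideanSpace.single i 1)))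
    linarith

theorem norm_iteratedFDeriv_fderiv_apply_le {E F : Type*} [NormedAddCommGroup E]
    [NormedSpace ℝ E] [NormedAddCommGroup F] [NormedSpace ℝ F] {u : E → F}
    (hu : ContDiff ℝ (⊤ : ℕ∞) u) (v x : E) (j : ℕ) :
    ‖iteratedFDeriv ℝ j (fun y => fderiv ℝ u y v) x‖ ≤
      ‖v‖ * ‖iteratedFDeriv ℝ (j + 1) u x‖ := by
  have hf : ContDiff ℝ (⊤ : ℕ∞) (fderiv ℝ u) := hu.fderiv_right (by simp)
  refine (norm_iteratedFDeriv_clm_apply_const hf.contDiffAt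
    (by exact_mod_cast le_top)).trans ?_
  rw [norm_iteratedFDeriv_fderiv]

theorem integral_weight_succ_le {d : ℕ} (k : ℕ)
    {u : EuclideanSpace ℝ (Fin d) → ℝ} (hu : ContDiff ℝ (⊤ : ℕ∞) u) (hs : HasCompactSupport u) :
    ∫ x, (1 + ‖x‖ ^ 2) ^ (k + 1) * u x ^ 2 ∂(gaussianCov2 d) ≤
      (1 + d * (4 + 8 * (k : ℝ))) * ∫ x, (1 + ‖x‖ ^ 2) ^ k * u x ^ 2 ∂(gaussianCov2 d) +
      16 * ∑ i, ∫ x, (1 + ‖x‖ ^ 2) ^ k * fderiv ℝ u x (EuclideanSpace.single i 1) ^ 2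
        ∂(gaussianCov2 d) := by
  have hc : Continuous u := hu.continuous
  have i1 (i : Fin d) :
      Integrable (fun x => x i ^ 2 * (1 + ‖x‖ ^ 2) ^ k * u x ^ 2) (gaussianCov2 d) := by
    simp_rw [pow_two (u _), ← mul_assoc]
    exact Continuous.integrable_gaussianCov2 (by fun_prop) hs.mul_left
  have i2 : Integrable (fun x => (1 + ‖x‖ ^ 2) ^ k * u x ^ 2) (gaussianCov2 d) := by
    simp_rw [pow_two (u _), ← mul_assoc]
    exact Continuous.integrable_gaussianCov2 (by fun_prop) hs.mul_left
  have hsplit (x : EuclideanSpace ℝ (Fin d)) : (1 + ‖x‖ ^ 2) ^ (k + 1) * u x ^ 2 =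
      (1 + ‖x‖ ^ 2) ^ k * u x ^ 2 + ∑ i, x i ^ 2 * (1 + ‖x‖ ^ 2) ^ k * u x ^ 2 := by
    rw [← Finset.sum_mul, ← Finset.sum_mul, ← EuclideanSpace.real_norm_sq_eq]
    ring
  simp_rw [hsplit]
  rw [integral_add i2 (integrable_finsetSum _ fun i _ => i1 i),
    integral_finsetSum _ fun i _ => i1 i]
  have h := Finset.sum_le_sum fun (i : Fin d) (_ : i ∈ Finset.univ) =>
    integral_coord_sq_mul_le k i hu hs
  rw [Finset.sum_add_distrib, Finset.sum_const, ← Finset.mul_sum, Finset.card_univ,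
    Fintype.card_fin, nsmul_eq_mul] at h
  linarith

theorem integrable_norm_iteratedFDeriv_sq {d : ℕ}
    {u : EuclideanSpace ℝ (Fin d) → ℝ} (hu : ContDiff ℝ (⊤ : ℕ∞) u) (hs : HasCompactSupport u)
    (j : ℕ) : Integrable (fun x => ‖iteratedFDeriv ℝ j u x‖ ^ 2) (gaussianCov2 d) := by
  have hc : Continuous (iteratedFDeriv ℝ j u) :=
    hu.continuous_iteratedFDeriv (by exact_mod_cast le_top)
  simp_rw [pow_two]
  exact Continuous.integrable_gaussianCov2 (by fun_prop) (hs.iteratedFDeriv j).norm.mul_left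

theorem sum_integral_iteratedFDeriv_partial_le {d : ℕ} (k : ℕ) (i : Fin d)
    {u : EuclideanSpace ℝ (Fin d) → ℝ} (hu : ContDiff ℝ (⊤ : ℕ∞) u) (hs : HasCompactSupport u) :
    ∑ j ∈ Finset.range (k + 1),
        ∫ x, ‖iteratedFDeriv ℝ j (fun y => fderiv ℝ u y (EuclideanSpace.single i 1)) x‖ ^ 2
          ∂(gaussianCov2 d) ≤
      ∑ j ∈ Finset.range (k + 2), ∫ x, ‖iteratedFDeriv ℝ j u x‖ ^ 2 ∂(gaussianCov2 d) := by
  have hf : ContDiff ℝ (⊤ : ℕ∞) fun y => fderiv ℝ u y (EuclideanSpace.single i 1) :=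
    (hu.fderiv_right (by simp)).clm_apply contDiff_const
  rw [Finset.sum_range_succ' _ (k + 1)]
  refine le_add_of_le_of_nonneg (Finset.sum_le_sum fun j _ => ?_)
    (integral_nonneg fun x => by positivity)
  refine integral_mono (integrable_norm_iteratedFDeriv_sq hf (hs.fderiv_apply ℝ _) j)
    (integrable_norm_iteratedFDeriv_sq hu hs (j + 1)) fun x => ?_
  have h := norm_iteratedFDeriv_fderiv_apply_le hu (EuclideanSpace.single i 1) x j
  rw [PiLp.norm_single, norm_one, one_mul] at h
  exact pow_le_pow_left₀ (norm_nonneg _) h 2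

theorem exists_gaussian_concentration_const (d k : ℕ) :
    ∃ C : ℝ, 0 ≤ C ∧ ∀ u : EuclideanSpace ℝ (Fin d) → ℝ,
      ContDiff ℝ (⊤ : ℕ∞) u → HasCompactSupport u →
      (∫ x, (1 + ‖x‖ ^ 2) ^ k * (u x) ^ 2 ∂(gaussianCov2 d))
        ≤ C * ∑ j ∈ Finset.range (k + 1),
            ∫ x, ‖iteratedFDeriv ℝ j u x‖ ^ 2 ∂(gaussianCov2 d) := by
  induction k with
  | zero => exact ⟨1, zero_le_one, fun u _ _ => by simp⟩
  | succ k ih =>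
    obtain ⟨C, hC, h⟩ := ih
    refine ⟨(1 + d * (4 + 8 * k)) * C + 16 * (d * C), by positivity, fun u hu hs => ?_⟩
    set S := ∑ j ∈ Finset.range (k + 1 + 1),
      ∫ x, ‖iteratedFDeriv ℝ j u x‖ ^ 2 ∂(gaussianCov2 d) with hS
    have h1 : ∫ x, (1 + ‖x‖ ^ 2) ^ k * u x ^ 2 ∂(gaussianCov2 d) ≤ C * S := by
      refine (h u hu hs).trans (mul_le_mul_of_nonneg_left ?_ hC)
      rw [hS, Finset.sum_range_succ _ (k + 1)]
      exact le_add_of_nonneg_right (integral_nonneg fun x => by positivity)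
    have h2 (i : Fin d) : ∫ x, (1 + ‖x‖ ^ 2) ^ k *
        fderiv ℝ u x (EuclideanSpace.single i 1) ^ 2 ∂(gaussianCov2 d) ≤ C * S :=
      (h _ ((hu.fderiv_right (by simp)).clm_apply contDiff_const) (hs.fderiv_apply ℝ _)).trans
        (mul_le_mul_of_nonneg_left (sum_integral_iteratedFDeriv_partial_le k i hu hs) hC)
    have h3 := Finset.sum_le_sum fun (i : Fin d) (_ : i ∈ Finset.univ) => h2 i
    rw [Finset.sum_const, Finset.card_univ, Fintype.card_fin, nsmul_eq_mul] at h3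
    have h4 := mul_le_mul_of_nonneg_left h1 (by positivity : (0 : ℝ) ≤ 1 + d * (4 + 8 * k))
    linarith [integral_weight_succ_le k hu hs]

/-- Gaussian concentration inequality:
`∫ (1+|x|²)^k u² dγ_d ≤ C(d,k) Σ_{j≤k} ∫ |D^j u|² dγ_d` for every compactly
supported smooth `u : ℝ^d → ℝ`. -/
theorem gaussian_concentration_inequality (d k : ℕ) (hd : 1 ≤ d) :
    ∃ C : ℝ, ∀ u : EuclideanSpace ℝ (Fin d) → ℝ,
      ContDiff ℝ (⊤ : ℕ∞) u → HasCompactSupport u →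
      (∫ x, (1 + ‖x‖ ^ 2) ^ k * (u x) ^ 2 ∂(gaussianCov2 d))
        ≤ C * ∑ j ∈ Finset.range (k + 1),
            ∫ x, ‖iteratedFDeriv ℝ j u x‖ ^ 2 ∂(gaussianCov2 d) := by
  obtain ⟨C, _, h⟩ := exists_gaussian_concentration_const d k
  exact ⟨C, h⟩
end

section
/- Let θ > 0, α ∈ (0,1) and q satisfy (1−α)/α < q < 1/θ, and assume additionally α(1 + 1/θ) > 1. Let C₀ > 0. There exists a constant C depending only on θ, α, q and C₀ such that for all integers 1 ≤ k ≤ N and every nonincreasing sequence (a_l)_{l=0}^{N} of reals with 0 ≤ a_l ≤ C₀·(l+1)^{−1/θ} for all l, one has Σ_{l=k}^{N} (a_{l−1} − a_l)^{α} ≤ C · k^{1 − α − α/θ}. In particular, since 1 − α − α/θ < 0, this sum tends to 0 as k → ∞, uniformly in N. -/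
theorem rpow_succ_sub_mul_le_rpow_sub {q b x : ℝ} (hq : 0 < q) (hqb : q < b) (hx : 0 < x) :
    (x + 1) ^ (-b) * ((x + 1) ^ q - x ^ q)
      ≤ q / (b - q) * (x ^ (q - b) - (x + 1) ^ (q - b)) := by
  have hs : 0 < b - q := sub_pos.2 hqb
  have hx1 : 0 < x + 1 := by linarith
  set L := Real.log (x + 1) - Real.log x with hL
  have h1 : x ^ q = (x + 1) ^ q * Real.exp (-(q * L)) := by
    rw [Real.rpow_def_of_pos hx, Real.rpow_def_of_pos hx1, ← Real.exp_add]
    congr 1; rw [hL]; ring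
  have h2 : x ^ (q - b) = (x + 1) ^ (q - b) * Real.exp ((b - q) * L) := by
    rw [Real.rpow_def_of_pos hx, Real.rpow_def_of_pos hx1, ← Real.exp_add]
    congr 1; rw [hL]; ring
  have h3 : (x + 1) ^ (q - b) = (x + 1) ^ (-b) * (x + 1) ^ q := by
    rw [← Real.rpow_add hx1]; congr 1; ring
  have h4 : 1 - Real.exp (-(q * L)) ≤ q * L := by
    linarith [Real.add_one_le_exp (-(q * L))]
  have h5 : q * L ≤ q / (b - q) * (Real.exp ((b - q) * L) - 1) := by
    calc q * L = q / (b - q) * ((b - q) * L) := by field_simp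
      _ ≤ _ := by
        gcongr
        linarith [Real.add_one_le_exp ((b - q) * L)]
  calc (x + 1) ^ (-b) * ((x + 1) ^ q - x ^ q)
      = (x + 1) ^ (q - b) * (1 - Real.exp (-(q * L))) := by rw [h1, h3]; ring
    _ ≤ (x + 1) ^ (q - b) * (q / (b - q) * (Real.exp ((b - q) * L) - 1)) := by
        gcongr
        exact h4.trans h5
    _ = _ := by rw [h2]; ring

theorem sum_Icc_rpow_neg_le {r : ℝ} (hr : 1 < r) {k N : ℕ} (hk : 1 ≤ k) (hkN : k ≤ N) :
    ∑ l ∈ Finset.Icc k N, (l : ℝ) ^ (-r) ≤ (1 + 1 / (r - 1)) * (k : ℝ) ^ (1 - r) := by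
  have hstrong : ∑ l ∈ Finset.Icc k N, (l : ℝ) ^ (-r)
      ≤ (k : ℝ) ^ (1 - r) + 1 / (r - 1) * ((k : ℝ) ^ (1 - r) - (N : ℝ) ^ (1 - r)) := by
    induction N, hkN using Nat.le_induction with
    | base =>
      have hk' : (1 : ℝ) ≤ k := by exact_mod_cast hk
      simpa using Real.rpow_le_rpow_of_exponent_le hk' (by linarith : -r ≤ 1 - r)
    | succ n hn ih =>
      have hn' : (0 : ℝ) < n := by exact_mod_cast hk.trans hn
      have h := rpow_succ_sub_mul_le_rpow_sub one_pos hr hn'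
      rw [Finset.sum_Icc_succ_top (by omega)]
      push_cast
      simp only [Real.rpow_one, add_sub_cancel_left, mul_one] at h
      linarith
  have hN : 0 ≤ 1 / (r - 1) * (N : ℝ) ^ (1 - r) :=
    mul_nonneg (one_div_nonneg.2 (by linarith)) (by positivity)
  linarith

theorem sum_Icc_sub_mul_rpow_le {q b C₀ : ℝ} (hq : 0 < q) (hqb : q < b) {k N : ℕ}
    (hk : 1 ≤ k) (hkN : k ≤ N) (hC₀ : 0 ≤ C₀) {a : ℕ → ℝ}
    (ha : ∀ l, l ≤ N → 0 ≤ a l ∧ a l ≤ C₀ * ((l : ℝ) + 1) ^ (-b)) :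
    ∑ l ∈ Finset.Icc k N, (a (l - 1) - a l) * (l : ℝ) ^ q
      ≤ C₀ * (1 + q / (b - q)) * (k : ℝ) ^ (q - b) := by
  have hstrong : ∑ l ∈ Finset.Icc k N, (a (l - 1) - a l) * (l : ℝ) ^ q
      ≤ C₀ * (k : ℝ) ^ (q - b)
        + C₀ * (q / (b - q) * ((k : ℝ) ^ (q - b) - (N : ℝ) ^ (q - b))) - a N * (N : ℝ) ^ q := by
    induction N, hkN using Nat.le_induction with
    | base =>
      have hk' : (0 : ℝ) < k := by exact_mod_cast hk
      have h := (ha (k - 1) (by omega)).2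
      rw [Nat.cast_sub hk, Nat.cast_one, sub_add_cancel] at h
      have h' := mul_le_mul_of_nonneg_right h (Real.rpow_nonneg hk'.le q)
      rw [mul_assoc, ← Real.rpow_add hk', neg_add_eq_sub] at h'
      simp only [Finset.Icc_self, Finset.sum_singleton, sub_self, mul_zero, add_zero]
      linarith
    | succ n hn ih =>
      have hn' : (0 : ℝ) < n := by exact_mod_cast hk.trans hn
      have ih' := ih fun l hl => ha l (by omega)
      have h := mul_le_mul_of_nonneg_left (rpow_succ_sub_mul_le_rpow_sub hq hqb hn') hC₀
      have hmono : (n : ℝ) ^ q ≤ ((n : ℝ) + 1) ^ q := by gcongr; linarith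
      have h' := mul_le_mul_of_nonneg_right (ha n (by omega)).2 (sub_nonneg.2 hmono)
      rw [Finset.sum_Icc_succ_top (by omega)]
      push_cast
      linarith
  have hN : 0 ≤ C₀ * (q / (b - q) * (N : ℝ) ^ (q - b)) :=
    mul_nonneg hC₀ (mul_nonneg (div_nonneg hq.le (by linarith)) (by positivity))
  have haN : 0 ≤ a N * (N : ℝ) ^ q := mul_nonneg (ha N le_rfl).1 (by positivity)
  linarith


/-- Hölder-summability estimate. For `θ > 0`, `α ∈ (0,1)` with
`(1−α)/α < q < 1/θ` and `α(1+1/θ) > 1`, there is `C = C(θ,α,q,C₀)` such that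
for any `1 ≤ k ≤ N` and any nonincreasing sequence with
`0 ≤ a_l ≤ C₀ (l+1)^{-1/θ}` on `{0,…,N}`,
`Σ_{l=k}^N (a_{l-1} − a_l)^α ≤ C k^{1−α−α/θ}`. -/
theorem holder_summability (θ α q C₀ : ℝ) (hθ : 0 < θ)
    (hα0 : 0 < α) (hα1 : α < 1)
    (hq1 : (1 - α) / α < q) (hq2 : q < 1 / θ)
    (hαθ : 1 < α * (1 + 1 / θ)) (hC₀ : 0 < C₀) :
    ∃ C : ℝ, ∀ (k N : ℕ), 1 ≤ k → k ≤ N → ∀ a : ℕ → ℝ,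
      (∀ l, l < N → a (l + 1) ≤ a l) →
      (∀ l, l ≤ N → 0 ≤ a l ∧ a l ≤ C₀ * ((l : ℝ) + 1) ^ (-(1 / θ))) →
      ∑ l ∈ Finset.Icc k N, (a (l - 1) - a l) ^ α
        ≤ C * (k : ℝ) ^ (1 - α - α / θ) := by
  have hq : 0 < q := (div_pos (by linarith) hα0).trans hq1
  have hβ : 0 < 1 - α := by linarith
  set r := q * α / (1 - α) with hr_def
  have hr : 1 < r := by
    rw [hr_def, lt_div_iff₀ hβ, one_mul]
    exact (div_lt_iff₀ hα0).1 hq1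
  have hrβ : r * (1 - α) = q * α := div_mul_cancel₀ _ hβ.ne'
  refine ⟨α * (C₀ * (1 + q / (1 / θ - q))) + (1 - α) * (1 + 1 / (r - 1)), ?_⟩
  intro k N hk hkN a hanti ha
  have hk0 : (0 : ℝ) < k := by exact_mod_cast hk
  have hterm : ∀ l ∈ Finset.Icc k N, (a (l - 1) - a l) ^ α ≤
      (k : ℝ) ^ (1 - α - α / θ) *
        (α * ((a (l - 1) - a l) * (l : ℝ) ^ q * (k : ℝ) ^ (1 / θ - q))
          + (1 - α) * ((l : ℝ) ^ (-r) * (k : ℝ) ^ (r - 1))) := by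
    intro l hl
    obtain ⟨hkl, hlN⟩ := Finset.mem_Icc.1 hl
    have hl0 : (0 : ℝ) < l := by exact_mod_cast hk.trans hkl
    have hd : 0 ≤ a (l - 1) - a l := by
      have h := hanti (l - 1) (by omega)
      rw [Nat.sub_add_cancel (hk.trans hkl)] at h
      linarith
    have young := Real.geom_mean_le_arith_mean2_weighted hα0.le hβ.le
      (p₁ := (a (l - 1) - a l) * (l : ℝ) ^ q * (k : ℝ) ^ (1 / θ - q))
      (p₂ := (l : ℝ) ^ (-r) * (k : ℝ) ^ (r - 1)) (by positivity) (by positivity) (by ring)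
    refine le_of_eq_of_le ?_ (mul_le_mul_of_nonneg_left young (Real.rpow_nonneg hk0.le _))
    rw [Real.mul_rpow (by positivity) (by positivity), Real.mul_rpow hd (by positivity),
      Real.mul_rpow (by positivity) (by positivity), ← Real.rpow_mul hl0.le,
      ← Real.rpow_mul hk0.le, ← Real.rpow_mul hl0.le, ← Real.rpow_mul hk0.le]
    have hl1 : (l : ℝ) ^ (q * α) * (l : ℝ) ^ (-r * (1 - α)) = 1 := by
      rw [← Real.rpow_add hl0, neg_mul, hrβ, add_neg_cancel, Real.rpow_zero]
    have hk1 : (k : ℝ) ^ (1 - α - α / θ) * (k : ℝ) ^ ((1 / θ - q) * α)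
        * (k : ℝ) ^ ((r - 1) * (1 - α)) = 1 := by
      rw [← Real.rpow_add hk0, ← Real.rpow_add hk0, sub_mul r, hrβ]
      convert Real.rpow_zero (k : ℝ) using 2
      ring
    calc (a (l - 1) - a l) ^ α
        = (a (l - 1) - a l) ^ α * ((l : ℝ) ^ (q * α) * (l : ℝ) ^ (-r * (1 - α)))
          * ((k : ℝ) ^ (1 - α - α / θ) * (k : ℝ) ^ ((1 / θ - q) * α)
            * (k : ℝ) ^ ((r - 1) * (1 - α))) := by rw [hl1, hk1, mul_one, mul_one]
      _ = _ := by ring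
  refine (Finset.sum_le_sum hterm).trans ?_
  rw [← Finset.mul_sum, Finset.sum_add_distrib, ← Finset.mul_sum, ← Finset.mul_sum,
    ← Finset.sum_mul, ← Finset.sum_mul, mul_comm]
  have h1 := mul_le_mul_of_nonneg_right (sum_Icc_sub_mul_rpow_le hq hq2 hk hkN hC₀.le ha)
    (Real.rpow_nonneg hk0.le (1 / θ - q))
  have h2 := mul_le_mul_of_nonneg_right (sum_Icc_rpow_neg_le hr hk hkN)
    (Real.rpow_nonneg hk0.le (r - 1))
  rw [mul_assoc, ← Real.rpow_add hk0, sub_add_sub_cancel, sub_self, Real.rpow_zero,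
    mul_one] at h1 h2
  gcongr
end

section
/- Let α ∈ (1/4, 1), let θ ∈ (1/3, 1) satisfy α(1 + 1/θ) > 1, let C₀ > 0 and ε > 0. There exists δ > 0, depending only on α, θ, C₀ and ε, such that the following holds. Let N′ < N be integers, let Θ ∈ ℝ, and let (W_j)_{j=N′}^{N} be a nondecreasing finite sequence of reals satisfying the discrete Lojasiewicz inequality |W_j − Θ|^{1+θ} ≤ C₀ · (W_{j+1} − W_{j−1}) for all N′+1 ≤ j ≤ N−1, together with the smallness condition W_N − W_{N′} < δ. Then Σ_{j=N′+1}^{N} (W_j − W_{j−1})^{α} < ε. -/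
open Filter Topology in
theorem eventually_mul_rpow_lt (c : ℝ) {s e : ℝ} (hs : 0 < s) (he : 0 < e) :
    ∀ᶠ x in 𝓝[>] (0 : ℝ), c * x ^ s < e := by
  have h : Tendsto (fun x : ℝ => c * x ^ s) (𝓝 0) (𝓝 (c * (0 : ℝ) ^ s)) :=
    ((Real.continuous_rpow_const hs.le).tendsto 0).const_mul c
  rw [Real.zero_rpow hs.ne', mul_zero] at h
  exact (h.mono_left nhdsWithin_le_nhds).eventually (gt_mem_nhds he)

/-- The odd extension of `u ↦ u ^ β` from the nonnegative reals. -/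
noncomputable def signedRpow (β u : ℝ) : ℝ := max u 0 ^ β - max (-u) 0 ^ β

theorem signedRpow_neg (β u : ℝ) : signedRpow β (-u) = -signedRpow β u := by
  simp [signedRpow]

theorem signedRpow_mono {β : ℝ} (hβ : 0 < β) : Monotone (signedRpow β) := by
  intro x y h
  unfold signedRpow
  have h1 : max x 0 ^ β ≤ max y 0 ^ β :=
    Real.rpow_le_rpow (le_max_right _ _) (max_le_max_right 0 h) hβ.le
  have h2 : max (-y) 0 ^ β ≤ max (-x) 0 ^ β :=
    Real.rpow_le_rpow (le_max_right _ _) (max_le_max_right 0 (neg_le_neg h)) hβ.le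
  linarith

theorem abs_signedRpow_le {β u r : ℝ} (hβ : 0 < β) (h : |u| ≤ r) :
    |signedRpow β u| ≤ r ^ β := by
  have hr : 0 ≤ r := (abs_nonneg u).trans h
  obtain ⟨h1, h2⟩ := abs_le.1 h
  have h3 : max u 0 ^ β ≤ r ^ β := Real.rpow_le_rpow (le_max_right _ _) (max_le h2 hr) hβ.le
  have h4 : max (-u) 0 ^ β ≤ r ^ β :=
    Real.rpow_le_rpow (le_max_right _ _) (max_le (by linarith) hr) hβ.le
  have h5 : 0 ≤ max u 0 ^ β := Real.rpow_nonneg (le_max_right _ _) _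
  have h6 : 0 ≤ max (-u) 0 ^ β := Real.rpow_nonneg (le_max_right _ _) _
  unfold signedRpow
  exact abs_le.2 ⟨by linarith, by linarith⟩

theorem mul_sub_le_rpow_sub_rpow {β a b R : ℝ} (hβ : 0 < β) (hβ1 : β ≤ 1) (ha : 0 ≤ a)
    (hab : a ≤ b) (hbR : b ≤ R) : β * R ^ (β - 1) * (b - a) ≤ b ^ β - a ^ β := by
  rcases (ha.trans hab).eq_or_lt with hb | hb
  · obtain rfl : a = b := by linarith
    simp
  have h1 : (1 + (a / b - 1)) ^ β ≤ 1 + β * (a / b - 1) :=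
    rpow_one_add_le_one_add_mul_self (by linarith [div_nonneg ha hb.le]) hβ.le hβ1
  rw [add_sub_cancel, Real.div_rpow ha hb.le, div_le_iff₀ (by positivity)] at h1
  have h2 : R ^ (β - 1) ≤ b ^ (β - 1) := Real.rpow_le_rpow_of_nonpos hb hbR (by linarith)
  have h3 : b ^ β = b ^ (β - 1) * b := by
    rw [← Real.rpow_add_one hb.ne', sub_add_cancel]
  have h4 : (1 + β * (a / b - 1)) * b ^ β = b ^ β - β * b ^ (β - 1) * (b - a) := by
    rw [h3]
    field_simp
    ring
  have h5 : β * R ^ (β - 1) * (b - a) ≤ β * b ^ (β - 1) * (b - a) := by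
    have := sub_nonneg.2 hab
    gcongr
  linarith

theorem mul_sub_le_signedRpow_sub {β x z R : ℝ} (hβ : 0 < β) (hβ1 : β ≤ 1) (hx : -R ≤ x)
    (hxz : x ≤ z) (hz : z ≤ R) :
    β * R ^ (β - 1) * (z - x) ≤ signedRpow β z - signedRpow β x := by
  have hR : 0 ≤ R := by linarith
  have h1 := mul_sub_le_rpow_sub_rpow hβ hβ1 (le_max_right x 0) (max_le_max_right 0 hxz)
    (max_le hz hR)
  have h2 := mul_sub_le_rpow_sub_rpow hβ hβ1 (le_max_right (-z) 0)
    (max_le_max_right 0 (neg_le_neg hxz)) (max_le (by linarith : -x ≤ R) hR)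
  have h3 : z - x = (max z 0 - max x 0) + (max (-x) 0 - max (-z) 0) := by
    have h4 := max_zero_sub_max_neg_zero_eq_self z
    have h5 := max_zero_sub_max_neg_zero_eq_self x
    linarith
  rw [h3, mul_add]
  unfold signedRpow
  linarith

/-- If the middle of three ordered points dominates the left one and satisfies a Lojasiewicz
inequality, then the left gap is controlled by an increment of `signedRpow`. -/
theorem gap_rpow_le_of_abs_le {α θ C β x y z : ℝ} (hα1 : α < 1) (hθ : 0 < θ)
    (hC : 0 < C) (hβ : 0 < β) (hβα : β = α * (1 + θ) - θ) (hxy : x ≤ y) (hyz : y ≤ z)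
    (hx : |x| ≤ y) (hy : y ≤ 1 / 2) (hL : y ^ (1 + θ) ≤ C * (z - x)) :
    (y - x) ^ α ≤ 2 * (1 + C ^ (1 - α)) / β * (signedRpow β z - signedRpow β x) := by
  have hβle : β ≤ α := by nlinarith
  have hα : 0 < α := hβ.trans_le hβle
  have hCp : 0 < C ^ (1 - α) := Real.rpow_pos_of_pos hC _
  obtain ⟨hx1, hx2⟩ := abs_le.1 hx
  have hmono := signedRpow_mono hβ
  rcases ((abs_nonneg x).trans hx).eq_or_lt with hy0 | hy0
  · have : y - x = 0 := by linarith
    rw [this, Real.zero_rpow hα.ne']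
    exact mul_nonneg (by positivity) (sub_nonneg.2 (hmono (hxy.trans hyz)))
  have hRp : 0 < (2 * y) ^ (β - 1) := by positivity
  suffices h : ∃ t ≤ z, x ≤ t ∧ t ≤ 2 * y ∧
      (y - x) ^ α ≤ 2 * (1 + C ^ (1 - α)) * ((2 * y) ^ (β - 1) * (t - x)) by
    obtain ⟨t, htz, hxt, hty, ht⟩ := h
    have h1 := mul_sub_le_signedRpow_sub hβ (by linarith) (by linarith) hxt hty
    have h2 := hmono htz
    have h3 : (2 * y) ^ (β - 1) * (t - x) ≤ (signedRpow β z - signedRpow β x) / β := by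
      rw [le_div_iff₀ hβ]
      linarith
    calc _ ≤ _ := ht
      _ ≤ 2 * (1 + C ^ (1 - α)) * ((signedRpow β z - signedRpow β x) / β) := by gcongr
      _ = _ := by ring
  rcases le_total (2 * y) z with hz | hz
  · refine ⟨2 * y, hz, by linarith, le_rfl, ?_⟩
    have h1 : (y - x) ^ α ≤ (2 * y) ^ α :=
      Real.rpow_le_rpow (by linarith) (by linarith) hα.le
    have h2 : (2 * y) ^ α ≤ (2 * y) ^ β :=
      Real.rpow_le_rpow_of_exponent_ge (by linarith) (by linarith) hβle
    have h3 : (2 * y) ^ β = (2 * y) ^ (β - 1) * (2 * y) := by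
      rw [← Real.rpow_add_one (by positivity), sub_add_cancel]
    have h4 : (2 * y) ^ (β - 1) * (2 * y) ≤ (2 * y) ^ (β - 1) * (2 * (2 * y - x)) := by
      gcongr
      linarith
    have h5 : 0 ≤ C ^ (1 - α) * ((2 * y) ^ (β - 1) * (2 * y - x)) := by
      have : 0 ≤ 2 * y - x := by linarith
      positivity
    linarith
  · refine ⟨z, le_rfl, by linarith, hz, ?_⟩
    have hD : 0 < z - x := by
      have : 0 < C * (z - x) := (Real.rpow_pos_of_pos hy0 _).trans_le hL
      exact pos_of_mul_pos_right this hC.le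
    have h1 : (y - x) ^ α ≤ (z - x) ^ α :=
      Real.rpow_le_rpow (by linarith) (by linarith) hα.le
    have h2 : (z - x) ^ α = (z - x) ^ (α - 1) * (z - x) := by
      rw [← Real.rpow_add_one hD.ne', sub_add_cancel]
    have h3 : (C * (z - x)) ^ (α - 1) ≤ (y ^ (1 + θ)) ^ (α - 1) :=
      Real.rpow_le_rpow_of_nonpos (by positivity) hL (by linarith)
    have h4 : (y ^ (1 + θ)) ^ (α - 1) = y ^ (β - 1) := by
      rw [← Real.rpow_mul hy0.le, hβα]
      ring_nf
    have h5 : C ^ (1 - α) * C ^ (α - 1) = 1 := by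
      rw [← Real.rpow_add hC]
      simp
    have h6 : (z - x) ^ (α - 1) ≤ C ^ (1 - α) * y ^ (β - 1) := by
      rw [h4, Real.mul_rpow hC.le hD.le] at h3
      calc (z - x) ^ (α - 1) = C ^ (1 - α) * (C ^ (α - 1) * (z - x) ^ (α - 1)) := by
            rw [← mul_assoc, h5, one_mul]
        _ ≤ _ := by gcongr
    have h7 : y ^ (β - 1) ≤ 2 * (2 * y) ^ (β - 1) := by
      have h8 : (2 : ℝ) ^ (-1 : ℝ) ≤ 2 ^ (β - 1) :=
        Real.rpow_le_rpow_of_exponent_le (by norm_num) (by linarith)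
      rw [Real.rpow_neg_one] at h8
      rw [Real.mul_rpow zero_le_two hy0.le]
      have := Real.rpow_pos_of_pos hy0 (β - 1)
      nlinarith
    calc (y - x) ^ α ≤ (z - x) ^ (α - 1) * (z - x) := h1.trans_eq h2
      _ ≤ (C ^ (1 - α) * (2 * (2 * y) ^ (β - 1))) * (z - x) := by
          gcongr
          exact h6.trans (by gcongr)
      _ = 2 * C ^ (1 - α) * ((2 * y) ^ (β - 1) * (z - x)) := by ring
      _ ≤ _ := by
          gcongr
          linarith

theorem gap_rpow_le {α θ C β a x y z : ℝ} (hα1 : α < 1) (hθ : 0 < θ)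
    (hC : 0 < C) (hβ : 0 < β) (hβα : β = α * (1 + θ) - θ) (hax : a ≤ x) (hxy : x ≤ y)
    (hyz : y ≤ z) (hx : |x| ≤ 1 / 2) (hy : |y| ≤ 1 / 2)
    (hLx : |x| ^ (1 + θ) ≤ C * (y - a)) (hLy : |y| ^ (1 + θ) ≤ C * (z - x)) :
    (y - x) ^ α ≤ 2 * (1 + C ^ (1 - α)) / β * (signedRpow β z - signedRpow β a) := by
  have hα : 0 < α := by nlinarith
  have hCp : 0 < C ^ (1 - α) := Real.rpow_pos_of_pos hC _
  have hmono := signedRpow_mono hβ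
  rcases hxy.eq_or_lt with rfl | hlt
  · rw [sub_self, Real.zero_rpow hα.ne']
    exact mul_nonneg (by positivity) (sub_nonneg.2 (hmono (hax.trans hyz)))
  rcases le_total |x| |y| with h | h
  · have hy0 : 0 ≤ y := by
      by_contra! hn
      rw [abs_of_neg hn, abs_of_neg (by linarith)] at h
      linarith
    rw [abs_of_nonneg hy0] at h hy hLy
    refine (gap_rpow_le_of_abs_le hα1 hθ hC hβ hβα hxy hyz h hy hLy).trans ?_
    gcongr
    exact hmono hax
  · have hx0 : x ≤ 0 := by
      by_contra! hn
      rw [abs_of_pos hn, abs_of_pos (by linarith)] at h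
      linarith
    rw [abs_of_nonpos hx0] at h hx hLx
    have h1 := gap_rpow_le_of_abs_le (x := -y) (y := -x) (z := -a) hα1 hθ hC hβ hβα
      (neg_le_neg hxy) (neg_le_neg hax) (by rwa [abs_neg]) hx (by convert hLx using 2; ring)
    rw [signedRpow_neg, signedRpow_neg, neg_sub_neg, neg_sub_neg] at h1
    refine h1.trans ?_
    gcongr
    exact hmono hyz

theorem sum_gap_rpow_le {α θ C β δ η : ℝ} {w : ℕ → ℝ} {n : ℕ} (hα1 : α < 1) (hθ : 0 < θ)
    (hC : 0 < C) (hβ : 0 < β) (hβα : β = α * (1 + θ) - θ) (hη : η ≤ 1 / 2)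
    (hδη : δ ≤ η / 2) (hδC : C * δ ≤ (η / 2) ^ (1 + θ)) (hw : Monotone w)
    (hL : ∀ i, i + 2 ≤ n → |w (i + 1)| ^ (1 + θ) ≤ C * (w (i + 2) - w i))
    (hδ : w n - w 0 ≤ δ) :
    ∑ i ∈ Finset.range n, (w (i + 1) - w i) ^ α ≤
      2 * δ ^ α + 2 * (1 + C ^ (1 - α)) / β * (6 * η ^ β) := by
  have hα : 0 < α := by nlinarith
  have hCp : 0 < C ^ (1 - α) := Real.rpow_pos_of_pos hC _
  have hδ0 : 0 ≤ δ := (sub_nonneg.2 (hw n.zero_le)).trans hδ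
  have hη0 : 0 ≤ η := by linarith
  set K := 2 * (1 + C ^ (1 - α)) / β with hK
  have hK0 : 0 ≤ K := by positivity
  have hmono := signedRpow_mono hβ
  have hgap : ∀ i, i + 1 ≤ n → (w (i + 1) - w i) ^ α ≤ δ ^ α := fun i hi =>
    Real.rpow_le_rpow (sub_nonneg.2 (hw i.le_succ))
      (by linarith [hw hi, hw i.zero_le]) hα.le
  have hδα : 0 ≤ δ ^ α := Real.rpow_nonneg hδ0 _
  have hηβ : 0 ≤ K * (6 * η ^ β) := mul_nonneg hK0 (by positivity)
  obtain rfl | rfl | ⟨m, rfl⟩ : n = 0 ∨ n = 1 ∨ ∃ m, n = m + 2 := by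
    rcases n with _ | _ | m
    · simp
    · simp
    · exact .inr (.inr ⟨m, rfl⟩)
  · rw [Finset.sum_range_zero]
    linarith
  · rw [Finset.sum_range_one]
    linarith [hgap 0 le_rfl]
  have hw1 : |w 1| ≤ η / 2 := by
    have h1 : |w 1| ^ (1 + θ) ≤ (η / 2) ^ (1 + θ) := by
      refine (hL 0 (by omega)).trans (le_trans ?_ hδC)
      gcongr
      linarith [hw (show 0 + 2 ≤ m + 2 by omega)]
    exact (Real.rpow_le_rpow_iff (abs_nonneg _) (by linarith) (by linarith)).1 h1
  have hbound : ∀ i ≤ m + 2, |w i| ≤ η := by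
    intro i hi
    obtain ⟨h1, h2⟩ := abs_le.1 hw1
    have h3 := hw hi
    have h4 := hw i.zero_le
    have h5 := hw (show 1 ≤ m + 2 by omega)
    have h6 := hw zero_le_one
    exact abs_le.2 ⟨by linarith, by linarith⟩
  have hsum : ∀ k ≤ m, ∑ i ∈ Finset.range (k + 1), (w (i + 1) - w i) ^ α ≤
      δ ^ α + K * (signedRpow β (w (k + 2)) + signedRpow β (w (k + 1)) + signedRpow β (w k)
        - 3 * signedRpow β (w 0)) := by
    intro k
    induction k with
    | zero =>
      intro _
      rw [Finset.sum_range_one]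
      have h1 := hmono (hw (Nat.zero_le (0 + 1)))
      have h2 := hmono (hw (Nat.zero_le (0 + 2)))
      have h3 := hgap 0 (by omega)
      have h4 := mul_nonneg hK0 (by linarith : 0 ≤ signedRpow β (w (0 + 2)) +
        signedRpow β (w (0 + 1)) + signedRpow β (w 0) - 3 * signedRpow β (w 0))
      linarith
    | succ k ih =>
      intro hk
      rw [Finset.sum_range_succ]
      have h1 := gap_rpow_le hα1 hθ hC hβ hβα (hw k.le_succ) (hw (k + 1).le_succ)
        (hw (k + 2).le_succ) ((hbound (k + 1) (by omega)).trans hη)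
        ((hbound (k + 2) (by omega)).trans hη) (hL k (by omega)) (hL (k + 1) (by omega))
      rw [← hK] at h1
      have h2 := ih (by omega)
      simp only [Nat.succ_eq_add_one, add_assoc, Nat.reduceAdd] at h1 h2 ⊢
      linarith
  have h1 := hsum m le_rfl
  have h2 := hgap (m + 1) le_rfl
  have hφ : ∀ i ≤ m + 2, |signedRpow β (w i)| ≤ η ^ β := fun i hi =>
    abs_signedRpow_le hβ (hbound i hi)
  have h3 := (abs_le.1 (hφ (m + 2) le_rfl)).2
  have h4 := (abs_le.1 (hφ (m + 1) (by omega))).2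
  have h5 := (abs_le.1 (hφ m (by omega))).2
  have h6 := (abs_le.1 (hφ 0 (by omega))).1
  have h7 : K * (signedRpow β (w (m + 2)) + signedRpow β (w (m + 1)) + signedRpow β (w m)
        - 3 * signedRpow β (w 0)) ≤ K * (6 * η ^ β) := by
    gcongr
    linarith
  rw [Finset.sum_range_succ]
  linarith

/-- quantitative summability of entropy gaps at the sequence
level. Given `α ∈ (1/4,1)`, `θ ∈ (1/3,1)` with `α(1+1/θ) > 1`, `C₀ > 0` and
`ε > 0`, there is `δ > 0` such that any nondecreasing finite sequence
`(W_j)_{j=N′}^N` satisfying the discrete Lojasiewicz inequality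
`|W_j − Θ|^{1+θ} ≤ C₀ (W_{j+1} − W_{j−1})` for `N′+1 ≤ j ≤ N−1` and
`W_N − W_{N′} < δ` has `Σ_{j=N′+1}^N (W_j − W_{j−1})^α < ε`. -/
theorem entropy_gap_summability (α θ C₀ ε : ℝ)
    (hα1 : 1 / 4 < α) (hα2 : α < 1)
    (hθ1 : 1 / 3 < θ) (hθ2 : θ < 1)
    (hαθ : 1 < α * (1 + 1 / θ)) (hC₀ : 0 < C₀) (hε : 0 < ε) :
    ∃ δ : ℝ, 0 < δ ∧ ∀ (N' N : ℤ), N' < N → ∀ (Θ : ℝ) (W : ℤ → ℝ),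
      (∀ j, N' ≤ j → j < N → W j ≤ W (j + 1)) →
      (∀ j, N' + 1 ≤ j → j ≤ N - 1 →
        |W j - Θ| ^ (1 + θ) ≤ C₀ * (W (j + 1) - W (j - 1))) →
      W N - W N' < δ →
      ∑ j ∈ Finset.Icc (N' + 1) N, (W j - W (j - 1)) ^ α < ε := by
  have hθ : 0 < θ := by linarith
  have hα : 0 < α := by linarith
  obtain ⟨β, hβα⟩ : ∃ β, β = α * (1 + θ) - θ := ⟨_, rfl⟩
  have hβ : 0 < β := by
    have h : θ * 1 < θ * (α * (1 + 1 / θ)) := mul_lt_mul_of_pos_left hαθ hθ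
    have h' : θ * (α * (1 + 1 / θ)) = α * (1 + θ) := by
      field_simp
      ring
    linarith
  obtain ⟨η, ⟨hη, hη'⟩, hη0⟩ := (((eventually_mul_rpow_lt
    (2 * (1 + C₀ ^ (1 - α)) / β * 6) hβ (half_pos hε)).and
    (eventually_mul_rpow_lt 1 one_pos (half_pos one_pos))).and self_mem_nhdsWithin).exists
  replace hη0 : 0 < η := hη0
  have hηθ : 0 < (η / 2) ^ (1 + θ) := by positivity
  obtain ⟨δ, ⟨⟨hδ, hδη⟩, hδC⟩, hδ0⟩ := ((((eventually_mul_rpow_lt 2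
    hα (half_pos hε)).and
    (eventually_mul_rpow_lt 1 one_pos (half_pos hη0))).and
    (eventually_mul_rpow_lt C₀ one_pos hηθ)).and self_mem_nhdsWithin).exists
  rw [Real.rpow_one] at hη' hδη hδC
  refine ⟨δ, hδ0, fun N' N hN Θ W hW hL hWδ => ?_⟩
  obtain ⟨n, rfl⟩ : ∃ n : ℕ, N = N' + n := ⟨(N - N').toNat, by omega⟩
  set w : ℕ → ℝ := fun i => W (N' + (min i n : ℕ)) - Θ with hw
  have hwi : ∀ i ≤ n, w i = W (N' + i) - Θ := fun i hi => by rw [hw]; simp only [min_eq_left hi]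
  have hmono : Monotone w := by
    refine monotone_nat_of_le_succ fun i => ?_
    rcases le_or_gt n i with h | h
    · simp only [hw, min_eq_right h, min_eq_right (h.trans i.le_succ), le_refl]
    · rw [hwi i h.le, hwi (i + 1) h]
      have := hW (N' + i) (by omega) (by omega)
      rw [add_assoc] at this
      push_cast
      linarith
  have hLw : ∀ i, i + 2 ≤ n → |w (i + 1)| ^ (1 + θ) ≤ C₀ * (w (i + 2) - w i) := by
    intro i hi
    rw [hwi i (by omega), hwi (i + 1) (by omega), hwi (i + 2) hi, sub_sub_sub_cancel_right]
    convert hL (N' + (i + 1 : ℕ)) (by omega) (by omega) using 4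
    · push_cast
      ring_nf
    · push_cast
      ring_nf
  have hsum : ∑ j ∈ Finset.Icc (N' + 1) (N' + n), (W j - W (j - 1)) ^ α =
      ∑ i ∈ Finset.range n, (w (i + 1) - w i) ^ α := by
    symm
    refine Finset.sum_bij (fun i _ => N' + (i + 1 : ℕ)) ?_ ?_ ?_ ?_
    · intro i hi
      rw [Finset.mem_range] at hi
      rw [Finset.mem_Icc]
      omega
    · intro i _ k _ h
      omega
    · intro j hj
      rw [Finset.mem_Icc] at hj
      exact ⟨(j - N' - 1).toNat, by rw [Finset.mem_range]; omega, by omega⟩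
    · intro i hi
      rw [Finset.mem_range] at hi
      rw [hwi i hi.le, hwi (i + 1) hi, sub_sub_sub_cancel_right]
      congr 3
      push_cast
      ring_nf
  have hδw : w n - w 0 ≤ δ := by
    rw [hwi n le_rfl, hwi 0 n.zero_le, sub_sub_sub_cancel_right]
    simpa using hWδ.le
  rw [hsum]
  have := sum_gap_rpow_le hα2 hθ hC₀ hβ hβα (by linarith) (by linarith) hδC.le hmono hLw hδw
  linarith
end
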